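/- arXiv:0711.4509 — 11 statements merged into one kernel-verified Lean document; each statement's English description precedes it below -/
import Mathlib

section
/- Let p be an odd prime and let m, k be integers with m ≤ k ≤ 2m (so 0 ≤ k−m ≤ m ≤ k). Let f ∈ S_k(m, k−m). Then each of the following functions on ℤ/p^kℤ again belongs to S_k(m, k−m): (1) for every integer c, the function x ↦ e(c·x̃²/p^k)·f(x), where x̃ ∈ ℤ is any representative of x (the value is independent of this choice); (2) for every integer t coprime to p, the function x ↦ f(t·x); (3) for every integer r coprime to p, the function x ↦ p^{−k/2}·∑_{y ∈ ℤ/p^kℤ} f(y)·e(2·r·x̃·ỹ/p^k), where x̃, ỹ ∈ ℤ are any representatives of x, y (the value is independent of these choices). -/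
/-- `e(x) = exp(2πix)`. -/
noncomputable def e (x : ℝ) : ℂ := Complex.exp (2 * Real.pi * Complex.I * x)

/-- `S_k(m,n)` for the prime `p`: functions on `ℤ/p^kℤ` that are constant on residue
classes modulo `p^m` and supported on multiples of `p^n`. -/
def Sspace (p k m n : ℕ) : Set (ZMod (p ^ k) → ℂ) :=
  {f | (∀ x y : ZMod (p ^ k), ((p : ZMod (p ^ k)) ^ m ∣ x - y) → f x = f y) ∧
       (∀ x : ZMod (p ^ k), ¬ ((p : ZMod (p ^ k)) ^ n ∣ x) → f x = 0)}

theorem e_intCast_div_pow (p k : ℕ) [NeZero p] (j : ℤ) :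
    e ((j : ℝ) / (p : ℝ) ^ k) = ZMod.stdAddChar (j : ZMod (p ^ k)) := by
  rw [ZMod.stdAddChar_coe, e]
  push_cast
  congr 1
  ring

theorem ZMod.pow_mul_pow_sub_eq_zero {p m k : ℕ} (hmk : m ≤ k) :
    (p : ZMod (p ^ k)) ^ m * (p : ZMod (p ^ k)) ^ (k - m) = 0 := by
  rw [← pow_add, Nat.add_sub_cancel' hmk, ← Nat.cast_pow, ZMod.natCast_self]

theorem ZMod.mul_eq_zero_of_pow_dvd {p m k : ℕ} (hmk : m ≤ k) {a b : ZMod (p ^ k)}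
    (ha : (p : ZMod (p ^ k)) ^ m ∣ a) (hb : (p : ZMod (p ^ k)) ^ (k - m) ∣ b) :
    a * b = 0 :=
  zero_dvd_iff.1 (ZMod.pow_mul_pow_sub_eq_zero hmk ▸ mul_dvd_mul ha hb)

theorem ZMod.pow_sub_dvd_of_mul_pow_eq_zero {p m k : ℕ} [NeZero p] (hmk : m ≤ k)
    {x : ZMod (p ^ k)} (h : x * (p : ZMod (p ^ k)) ^ m = 0) :
    (p : ZMod (p ^ k)) ^ (k - m) ∣ x := by
  obtain ⟨n, rfl⟩ := ZMod.natCast_zmod_surjective x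
  rw [← Nat.cast_pow, ← Nat.cast_mul, ZMod.natCast_eq_zero_iff] at h
  have hdvd : p ^ (k - m) ∣ n := by
    refine Nat.dvd_of_mul_dvd_mul_right (pow_pos (NeZero.pos p) m) ?_
    rwa [← pow_add, Nat.sub_add_cancel hmk]
  simpa using Nat.cast_dvd_cast (α := ZMod (p ^ k)) hdvd

theorem ZMod.isUnit_intCast_of_gcd_eq_one {p : ℕ} (k : ℕ) {t : ℤ} (ht : Int.gcd t p = 1) :
    IsUnit (t : ZMod (p ^ k)) := by
  rw [ZMod.coe_int_isUnit_iff_isCoprime]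
  push_cast
  exact (Int.isCoprime_iff_gcd_eq_one.2 ht).symm.pow_left

theorem stmt0 (p : ℕ) [NeZero p] (hp : p.Prime) (hodd : Odd p) (m k : ℕ)
    (hmk : m ≤ k) (hk2m : k ≤ 2 * m)
    (f : ZMod (p ^ k) → ℂ) (hf : f ∈ Sspace p k m (k - m))
    (rep : ZMod (p ^ k) → ℤ) (hrep : ∀ x, ((rep x : ℤ) : ZMod (p ^ k)) = x) :
    (∀ c : ℤ,
      (fun x => e (((c * (rep x) ^ 2 : ℤ) : ℝ) / (p : ℝ) ^ k) * f x) ∈ Sspace p k m (k - m)) ∧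
    (∀ t : ℤ, Int.gcd t p = 1 →
      (fun x => f ((t : ZMod (p ^ k)) * x)) ∈ Sspace p k m (k - m)) ∧
    (∀ r : ℤ, Int.gcd r p = 1 →
      (fun x => ((((p : ℝ) ^ k) ^ (-(1 / 2) : ℝ) : ℝ) : ℂ) *
          ∑ y : ZMod (p ^ k), f y * e (((2 * r * rep x * rep y : ℤ) : ℝ) / (p : ℝ) ^ k))
        ∈ Sspace p k m (k - m)) := by
  obtain ⟨hper, hsupp⟩ := hf
  simp only [e_intCast_div_pow]
  simp only [Int.cast_mul, Int.cast_pow, hrep]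
  refine ⟨fun c => ⟨fun x y hxy => ?_, fun x hx => ?_⟩,
    fun t ht => ⟨fun x y hxy => ?_, fun x hx => ?_⟩,
    fun r hr => ⟨fun x y hxy => ?_, fun x hx => ?_⟩⟩
  · have hfxy := hper x y hxy
    by_cases hx : (p : ZMod (p ^ k)) ^ (k - m) ∣ x
    · have hxy' : (p : ZMod (p ^ k)) ^ (k - m) ∣ x - y :=
        (pow_dvd_pow _ (by omega)).trans hxy
      have hy : (p : ZMod (p ^ k)) ^ (k - m) ∣ y := (dvd_sub_right hx).1 hxy'
      have h := ZMod.mul_eq_zero_of_pow_dvd hmk hxy (dvd_add hx hy)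
      have hsq : (c : ZMod (p ^ k)) * x ^ 2 = c * y ^ 2 := by
        linear_combination (c : ZMod (p ^ k)) * h
      simp only [hsq, hfxy]
    · simp only [← hfxy, hsupp x hx, mul_zero]
  · simp only [hsupp x hx, mul_zero]
  · refine hper _ _ ?_
    rw [← mul_sub]
    exact hxy.mul_left _
  · exact hsupp _ fun h => hx ((ZMod.isUnit_intCast_of_gcd_eq_one k ht).dvd_mul_left.1 h)
  · dsimp only
    congr 1
    refine Finset.sum_congr rfl fun z _ => ?_
    by_cases hz : (p : ZMod (p ^ k)) ^ (k - m) ∣ z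
    · have h := ZMod.mul_eq_zero_of_pow_dvd hmk hxy hz
      congr 2
      linear_combination ((2 : ℤ) : ZMod (p ^ k)) * r * h
    · simp only [hsupp z hz, zero_mul]
  · have h2r : IsUnit (((2 : ℤ) : ZMod (p ^ k)) * r) :=
      (ZMod.isUnit_intCast_of_gcd_eq_one k (by
        simpa [Int.gcd] using hodd.coprime_two_left)).mul
        (ZMod.isUnit_intCast_of_gcd_eq_one k hr)
    set a : ZMod (p ^ k) := ((2 : ℤ) : ZMod (p ^ k)) * r
    have hne : ZMod.stdAddChar (a * x * (p : ZMod (p ^ k)) ^ m) ≠ 1 := fun h => by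
      rw [← AddChar.map_zero_eq_one (ZMod.stdAddChar (N := p ^ k))] at h
      have h0 := ZMod.injective_stdAddChar h
      rw [mul_assoc, h2r.mul_right_eq_zero] at h0
      exact hx (ZMod.pow_sub_dvd_of_mul_pow_eq_zero hmk h0)
    have hshift : ∑ y, f y * ZMod.stdAddChar (a * x * y) =
        ZMod.stdAddChar (a * x * (p : ZMod (p ^ k)) ^ m) *
          ∑ y, f y * ZMod.stdAddChar (a * x * y) := by
      conv_lhs => rw [← Equiv.sum_comp (Equiv.addRight ((p : ZMod (p ^ k)) ^ m))]
      rw [Finset.mul_sum]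
      refine Finset.sum_congr rfl fun y _ => ?_
      rw [Equiv.coe_addRight, hper (y + (p : ZMod (p ^ k)) ^ m) y (by simp), mul_add,
        AddChar.map_add_eq_mul]
      ring
    have h0 : ∑ y, f y * ZMod.stdAddChar (a * x * y) = 0 := by
      by_contra hS
      exact hne (mul_right_cancel₀ hS (by rw [one_mul, ← hshift]))
    dsimp only
    rw [h0, mul_zero]
end

section
/- Let m, k be integers with m+1 ≤ k ≤ 2m+1 (so 0 ≤ k−1−m ≤ m ≤ k) and let f ∈ S_k(m, k−1−m), taken with p = 2. Then each of the following functions on ℤ/2^kℤ again belongs to S_k(m, k−1−m): (1) for every odd integer r and every integer b divisible by 4, the function x ↦ e(r·b·x̃²/2^k)·f(x), where x̃ ∈ ℤ is any representative of x (the value is independent of this choice); (2) for every odd integer t, the function x ↦ f(t·x); (3) for every odd integer r, the function x ↦ 2^{−k/2}·∑_{y ∈ ℤ/2^kℤ} f(y)·e(2·r·x̃·ỹ/2^k), where x̃, ỹ ∈ ℤ are any representatives of x, y (the value is independent of these choices). -/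
theorem e_add (x y : ℝ) : e (x + y) = e x * e y := by
  simp only [e, ← Complex.exp_add]
  push_cast
  ring_nf

theorem e_div_eq_one_iff (k : ℕ) (a : ℤ) : e ((a : ℝ) / (2 : ℝ) ^ k) = 1 ↔ (2 : ℤ) ^ k ∣ a := by
  have hk : (2 : ℂ) ^ k ≠ 0 := pow_ne_zero k two_ne_zero
  rw [e, Complex.exp_eq_one_iff]
  constructor
  · rintro ⟨n, hn⟩
    refine ⟨n, ?_⟩
    have h : ((a : ℂ) / 2 ^ k) = n := by
      apply mul_left_cancel₀ Complex.two_pi_I_ne_zero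
      push_cast at hn
      rw [hn, mul_comm]
    rw [div_eq_iff hk] at h
    have h' : (a : ℂ) = ((2 ^ k * n : ℤ) : ℂ) := by push_cast; rw [h, mul_comm]
    exact_mod_cast h'
  · rintro ⟨n, rfl⟩
    refine ⟨n, ?_⟩
    push_cast
    field_simp

theorem e_div_congr {k : ℕ} {a b : ℤ} (h : (2 : ℤ) ^ k ∣ a - b) :
    e ((a : ℝ) / (2 : ℝ) ^ k) = e ((b : ℝ) / (2 : ℝ) ^ k) := by
  have hab : (a : ℝ) / (2 : ℝ) ^ k = ((a - b : ℤ) : ℝ) / (2 : ℝ) ^ k + (b : ℝ) / (2 : ℝ) ^ k := by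
    push_cast
    ring
  rw [hab, e_add, (e_div_eq_one_iff k (a - b)).2 h, one_mul]

theorem two_pow_dvd_intCast_iff {j k : ℕ} (hj : j ≤ k) (a : ℤ) :
    (((2 : ℕ) : ZMod (2 ^ k)) ^ j ∣ (a : ZMod (2 ^ k))) ↔ (2 : ℤ) ^ j ∣ a := by
  constructor
  · rintro ⟨c, hc⟩
    obtain ⟨c, rfl⟩ := ZMod.intCast_surjective c
    have h : (a : ZMod (2 ^ k)) = ((2 ^ j * c : ℤ) : ZMod (2 ^ k)) := by
      rw [hc]
      push_cast
      rfl
    rw [ZMod.intCast_eq_intCast_iff_dvd_sub] at h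
    push_cast at h
    exact (dvd_sub_right (Dvd.intro _ rfl)).1 ((pow_dvd_pow 2 hj).trans h)
  · rintro ⟨c, rfl⟩
    exact ⟨c, by push_cast; rfl⟩

theorem stmt1 (m k : ℕ) (hmk : m + 1 ≤ k) (hk2m : k ≤ 2 * m + 1)
    (f : ZMod (2 ^ k) → ℂ) (hf : f ∈ Sspace 2 k m (k - 1 - m))
    (rep : ZMod (2 ^ k) → ℤ) (hrep : ∀ x, ((rep x : ℤ) : ZMod (2 ^ k)) = x) :
    (∀ r b : ℤ, Odd r → (4 : ℤ) ∣ b →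
      (fun x => e (((r * b * (rep x) ^ 2 : ℤ) : ℝ) / (2 : ℝ) ^ k) * f x)
        ∈ Sspace 2 k m (k - 1 - m)) ∧
    (∀ t : ℤ, Odd t →
      (fun x => f ((t : ZMod (2 ^ k)) * x)) ∈ Sspace 2 k m (k - 1 - m)) ∧
    (∀ r : ℤ, Odd r →
      (fun x => ((((2 : ℝ) ^ k) ^ (-(1 / 2) : ℝ) : ℝ) : ℂ) *
          ∑ y : ZMod (2 ^ k), f y * e (((2 * r * rep x * rep y : ℤ) : ℝ) / (2 : ℝ) ^ k))
        ∈ Sspace 2 k m (k - 1 - m)) := by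
  obtain ⟨hconst, hsupp⟩ := hf
  obtain ⟨n, hn⟩ : ∃ n, n = k - 1 - m := ⟨_, rfl⟩
  rw [← hn] at hsupp ⊢
  have hk : k = 1 + m + n := by omega
  have hnm : n ≤ m := by omega
  have hpow : (2 : ℤ) ^ k = 2 * (2 ^ m * 2 ^ n) := by rw [hk]; ring
  have hdvd {j : ℕ} (hj : j ≤ k) (x : ZMod (2 ^ k)) :
      (((2 : ℕ) : ZMod (2 ^ k)) ^ j ∣ x) ↔ (2 : ℤ) ^ j ∣ rep x := by
    rw [← two_pow_dvd_intCast_iff hj, hrep]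
  have hdvd_sub (x y : ZMod (2 ^ k)) :
      (((2 : ℕ) : ZMod (2 ^ k)) ^ m ∣ x - y) ↔ (2 : ℤ) ^ m ∣ rep x - rep y := by
    rw [← two_pow_dvd_intCast_iff (by omega : m ≤ k), Int.cast_sub, hrep, hrep]
  have hsupp' (x : ZMod (2 ^ k)) (hx : f x ≠ 0) : (2 : ℤ) ^ n ∣ rep x := by
    by_contra h
    exact hx (hsupp x (mt (hdvd (by omega) x).1 h))
  have hcop (t : ℤ) (ht : Odd t) : IsCoprime ((2 : ℤ) ^ n) t :=
    (Int.isCoprime_two_left.2 ht).pow_left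
  refine ⟨fun r b _ hb => ⟨fun x y hxy => ?_, fun x hx => ?_⟩,
    fun t ht => ⟨fun x y hxy => ?_, fun x hx => ?_⟩,
    fun r hr => ⟨fun x y hxy => ?_, fun x hx => ?_⟩⟩
  · dsimp only
    rw [← hconst x y hxy]
    by_cases hfx : f x = 0
    · rw [hfx, mul_zero, mul_zero]
    congr 1
    apply e_div_congr
    obtain ⟨u, hu⟩ := (hdvd_sub x y).1 hxy
    obtain ⟨v, hv⟩ := hsupp' x hfx
    obtain ⟨w, hw⟩ := hsupp' y (hconst x y hxy ▸ hfx)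
    obtain ⟨c, rfl⟩ := hb
    refine ⟨r * (2 * c) * u * (v + w), ?_⟩
    calc r * (4 * c) * rep x ^ 2 - r * (4 * c) * rep y ^ 2
        = r * (4 * c) * (rep x - rep y) * (rep x + rep y) := by ring
      _ = 2 ^ k * (r * (2 * c) * u * (v + w)) := by rw [hu, hv, hw, hpow]; ring
  · dsimp only
    rw [hsupp x hx, mul_zero]
  · apply hconst
    rw [← mul_sub]
    exact hxy.mul_left _
  · refine hsupp _ fun h => hx ?_
    rw [← hrep x, ← Int.cast_mul, two_pow_dvd_intCast_iff (by omega)] at h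
    exact (hdvd (by omega) x).2 ((hcop t ht).dvd_of_dvd_mul_left h)
  · dsimp only
    congr 1
    refine Finset.sum_congr rfl fun z _ => ?_
    by_cases hfz : f z = 0
    · rw [hfz, zero_mul, zero_mul]
    congr 1
    apply e_div_congr
    obtain ⟨u, hu⟩ := (hdvd_sub x y).1 hxy
    obtain ⟨v, hv⟩ := hsupp' z hfz
    refine ⟨r * u * v, ?_⟩
    calc 2 * r * rep x * rep z - 2 * r * rep y * rep z
        = 2 * r * (rep x - rep y) * rep z := by ring
      _ = 2 ^ k * (r * u * v) := by rw [hu, hv, hpow]; ring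
  · dsimp only
    set c : ℂ := e (((2 * r * rep x * 2 ^ m : ℤ) : ℝ) / (2 : ℝ) ^ k) with hc
    have hc1 : c ≠ 1 := by
      rw [hc, Ne, e_div_eq_one_iff]
      rintro ⟨u, hu⟩
      refine hx ((hdvd (by omega) x).2 ((hcop r hr).dvd_of_dvd_mul_left ⟨u, ?_⟩))
      apply mul_left_cancel₀ (by positivity : (2 * 2 ^ m : ℤ) ≠ 0)
      rw [hpow] at hu
      linear_combination hu
    set S : ℂ := ∑ y : ZMod (2 ^ k), f y * e (((2 * r * rep x * rep y : ℤ) : ℝ) / (2 : ℝ) ^ k)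
      with hS
    have hshift : S = S * c := by
      rw [hS, Finset.sum_mul,
        ← Equiv.sum_comp (Equiv.addRight (((2 : ℕ) : ZMod (2 ^ k)) ^ m))]
      refine Finset.sum_congr rfl fun y _ => ?_
      simp only [Equiv.coe_addRight]
      rw [hconst (y + ((2 : ℕ) : ZMod (2 ^ k)) ^ m) y (by simp), mul_assoc (f y), hc,
        ← e_add, ← add_div, ← Int.cast_add]
      congr 1
      apply e_div_congr
      have h : (2 : ℤ) ^ k ∣ rep (y + ((2 : ℕ) : ZMod (2 ^ k)) ^ m) - (rep y + 2 ^ m) := by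
        have h' := (ZMod.intCast_eq_intCast_iff_dvd_sub (rep y + 2 ^ m)
          (rep (y + ((2 : ℕ) : ZMod (2 ^ k)) ^ m)) (2 ^ k)).1
            (by rw [hrep]; push_cast; rw [hrep])
        exact_mod_cast h'
      obtain ⟨u, hu⟩ := h
      exact ⟨2 * r * rep x * u, by linear_combination (2 * r * rep x) * hu⟩
    have hS0 : S = 0 := by
      by_contra h
      exact hc1 (mul_left_cancel₀ h (by rw [← hshift, mul_one]))
    rw [hS0, mul_zero]
end

section
/- Let p be an odd prime and let k, m be integers with 0 ≤ 2m ≤ k. For ψ ∈ S_k(k−m, m) define T_mψ : ℤ/p^{k−2m}ℤ → ℂ by (T_mψ)(x) = p^{−m/2}·ψ(p^m·x̃), where x̃ ∈ ℤ is any representative of x (the value is independent of this choice, since ψ is constant on residue classes modulo p^{k−m}). Then T_m is a ℂ-linear bijection from S_k(k−m, m) onto the space of all functions ℤ/p^{k−2m}ℤ → ℂ, and T_m preserves inner products: ⟨T_mφ, T_mψ⟩ = ⟨φ, ψ⟩ for all φ, ψ ∈ S_k(k−m, m), where the left-hand inner product is taken on ℤ/p^{k−2m}ℤ and the right-hand one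 on ℤ/p^kℤ. -/
/-- The normalized inner product `⟨f,g⟩ = (1/M) ∑ f(Q) conj(g(Q))` on `ℤ/Mℤ`. -/
noncomputable def inn (M : ℕ) [NeZero M] (f g : ZMod M → ℂ) : ℂ :=
  (M : ℂ)⁻¹ * ∑ x : ZMod M, f x * (starRingEnd ℂ) (g x)

theorem ZMod.sum_eq_sum_fin (n : ℕ) [NeZero n] (f : ZMod n → ℂ) :
    ∑ x : ZMod n, f x = ∑ i : Fin n, f ((i : ℕ) : ZMod n) := by
  refine Fintype.sum_equiv (⟨fun x => ⟨x.val, x.val_lt⟩, fun i => ((i : ℕ) : ZMod n),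
    fun x => by simp, fun i => Fin.ext (ZMod.val_cast_of_lt i.isLt)⟩ : ZMod n ≃ Fin n)
    _ _ fun x => by simp

/-- If `aN` divides `au` in `ℤ/aNaℤ`, then `u` vanishes modulo `N`. -/
theorem ZMod.castHom_eq_zero_of_mul_dvd {M a N : ℕ} (ha : a ≠ 0) (hM : M = a * N * a)
    (h : N ∣ M) {u : ZMod M} (hu : ((a * N : ℕ) : ZMod M) ∣ (a : ZMod M) * u) :
    ZMod.castHom h (ZMod N) u = 0 := by
  obtain ⟨w, hw⟩ := hu
  obtain ⟨u, rfl⟩ := ZMod.intCast_surjective u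
  obtain ⟨w, rfl⟩ := ZMod.intCast_surjective w
  have h1 : (((a : ℤ) * u : ℤ) : ZMod M) = (((a : ℤ) * N * w : ℤ) : ZMod M) := by
    push_cast at hw ⊢
    exact hw
  rw [ZMod.intCast_eq_intCast_iff_dvd_sub] at h1
  obtain ⟨t, ht⟩ := h1
  rw [map_intCast, CharP.intCast_eq_zero_iff (ZMod N) N]
  refine ⟨w - a * t, mul_left_cancel₀ (Nat.cast_ne_zero.mpr ha : (a : ℤ) ≠ 0) ?_⟩
  rw [hM] at ht
  push_cast at ht
  linear_combination -ht

/-- The sum over `ℤ/aNaℤ` of an `aN`-periodic function supported on multiples of `a`. -/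
theorem ZMod.sum_eq_mul_sum_of_periodic {M a N : ℕ} [NeZero M] [NeZero N] (ha : a ≠ 0)
    (hM : M = a * N * a) (f : ZMod M → ℂ)
    (hper : ∀ x y : ZMod M, ((a * N : ℕ) : ZMod M) ∣ x - y → f x = f y)
    (hsupp : ∀ x : ZMod M, ¬ (a : ZMod M) ∣ x → f x = 0) :
    ∑ x : ZMod M, f x = a * ∑ r : Fin N, f ((a : ZMod M) * ((r : ℕ) : ZMod M)) := by
  have : NeZero a := ⟨ha⟩
  have h1 : ∀ i : Fin (a * N),
      ∑ j : Fin a, f (((j + a * i : ℕ)) : ZMod M) = f ((a : ZMod M) * ((i : ℕ) : ZMod M)) := by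
    intro i
    rw [Finset.sum_eq_single (0 : Fin a)]
    · simp
    · intro j _ hj
      apply hsupp
      intro hdvd
      obtain ⟨c, hc⟩ := hdvd
      obtain ⟨c, rfl⟩ := ZMod.natCast_zmod_surjective c
      rw [← Nat.cast_mul, ZMod.natCast_eq_natCast_iff] at hc
      have h2 : (j + a * i : ℕ) ≡ a * c [MOD a] := hc.of_dvd (hM ▸ dvd_mul_left a (a * N))
      have h3 : (j : ℕ) % a = 0 := by simpa [Nat.ModEq] using h2
      rw [Nat.mod_eq_of_lt j.isLt] at h3
      exact hj (Fin.ext (by simpa using h3))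
    · simp
  have h2 : ∀ (s : Fin a) (r : Fin N), f ((a : ZMod M) * ((r + N * s : ℕ) : ZMod M)) =
      f ((a : ZMod M) * ((r : ℕ) : ZMod M)) := by
    intro s r
    apply hper
    exact ⟨(s : ℕ), by push_cast; ring⟩
  rw [ZMod.sum_eq_sum_fin]
  subst hM
  rw [← finProdFinEquiv.sum_comp, Fintype.sum_prod_type]
  simp only [finProdFinEquiv_apply_val, h1]
  rw [← finProdFinEquiv.sum_comp, Fintype.sum_prod_type]
  simp only [finProdFinEquiv_apply_val, h2]
  simp

theorem stmt2 (p : ℕ) [NeZero p] (hp : p.Prime) (hodd : Odd p) (k m : ℕ) (h2m : 2 * m ≤ k)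
    (T : (ZMod (p ^ k) → ℂ) → (ZMod (p ^ (k - 2 * m)) → ℂ))
    -- `T` is the map `ψ ↦ T_mψ`, `(T_mψ)(x) = p^{-m/2} ψ(p^m x̃)` for any representative
    -- `x̃ ∈ ℤ` of `x` (for `ψ ∈ S_k(k-m,m)` the value is independent of this choice):
    (hT : ∀ ψ ∈ Sspace p k (k - m) m, ∀ x' : ℤ,
      T ψ ((x' : ZMod (p ^ (k - 2 * m)))) =
        ((((p : ℝ) ^ m) ^ (-(1 / 2) : ℝ) : ℝ) : ℂ) *
          ψ ((p : ZMod (p ^ k)) ^ m * ((x' : ℤ) : ZMod (p ^ k)))) :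
    -- `T_m` is a bijection from `S_k(k-m,m)` onto the space of all functions on `ℤ/p^{k-2m}ℤ`,
    Set.BijOn T (Sspace p k (k - m) m) Set.univ ∧
    -- it is ℂ-linear,
    (∀ φ ∈ Sspace p k (k - m) m, ∀ ψ ∈ Sspace p k (k - m) m, ∀ a b : ℂ,
      T (a • φ + b • ψ) = a • T φ + b • T ψ) ∧
    -- and it preserves inner products.
    (∀ φ ∈ Sspace p k (k - m) m, ∀ ψ ∈ Sspace p k (k - m) m,
      inn (p ^ (k - 2 * m)) (T φ) (T ψ) = inn (p ^ k) φ ψ) := by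
  have ha : p ^ m ≠ 0 := pow_ne_zero _ hp.ne_zero
  have hb : p ^ (k - m) = p ^ m * p ^ (k - 2 * m) := by
    rw [← pow_add]; congr 1; omega
  have hM : p ^ k = p ^ m * p ^ (k - 2 * m) * p ^ m := by
    rw [← pow_add, ← pow_add]; congr 1; omega
  have hdvd : p ^ (k - 2 * m) ∣ p ^ k := pow_dvd_pow _ (Nat.sub_le _ _)
  set c : ℝ := ((p : ℝ) ^ m) ^ (-(1 / 2) : ℝ) with hc
  have hp0 : (0 : ℝ) < (p : ℝ) ^ m := pow_pos (Nat.cast_pos.mpr hp.pos) _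
  have hc0 : (c : ℂ) ≠ 0 := Complex.ofReal_ne_zero.mpr (Real.rpow_pos_of_pos hp0 _).ne'
  have hcc : (c : ℂ) * c = ((p : ℂ) ^ m)⁻¹ := by
    have : c * c = ((p : ℝ) ^ m)⁻¹ := by
      rw [hc, ← Real.rpow_add hp0, ← Real.rpow_neg_one]; norm_num
    rw [← Complex.ofReal_mul, this]; push_cast; rfl
  have hlin : ∀ φ ∈ Sspace p k (k - m) m, ∀ ψ ∈ Sspace p k (k - m) m, ∀ a b : ℂ,
      a • φ + b • ψ ∈ Sspace p k (k - m) m := by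
    intro φ hφ ψ hψ a b
    refine ⟨fun x y h => ?_, fun x h => ?_⟩
    · simp [hφ.1 x y h, hψ.1 x y h]
    · simp [hφ.2 x h, hψ.2 x h]
  refine ⟨⟨fun _ _ => Set.mem_univ _, ?_, ?_⟩, ?_, ?_⟩
  · intro φ hφ ψ hψ h
    funext x
    by_cases hx : (p : ZMod (p ^ k)) ^ m ∣ x
    · obtain ⟨y, rfl⟩ := hx
      obtain ⟨y, rfl⟩ := ZMod.intCast_surjective y
      have := congrFun h (y : ZMod (p ^ (k - 2 * m)))
      rw [hT φ hφ, hT ψ hψ] at this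
      exact mul_left_cancel₀ hc0 this
    · rw [hφ.2 x hx, hψ.2 x hx]
  · intro g _
    classical
    let ψ : ZMod (p ^ k) → ℂ := fun x =>
      if h : (p : ZMod (p ^ k)) ^ m ∣ x then
        (c : ℂ)⁻¹ * g (ZMod.castHom hdvd (ZMod (p ^ (k - 2 * m))) h.choose) else 0
    have hψval : ∀ u, ψ ((p : ZMod (p ^ k)) ^ m * u) =
        (c : ℂ)⁻¹ * g (ZMod.castHom hdvd (ZMod (p ^ (k - 2 * m))) u) := by
      intro u
      have h : (p : ZMod (p ^ k)) ^ m ∣ (p : ZMod (p ^ k)) ^ m * u := dvd_mul_right _ _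
      simp only [ψ, dif_pos h]
      congr 2
      rw [← sub_eq_zero, ← map_sub]
      refine ZMod.castHom_eq_zero_of_mul_dvd ha hM hdvd ?_
      rw [mul_sub, Nat.cast_pow, ← h.choose_spec, sub_self]
      exact dvd_zero _
    have hψ : ψ ∈ Sspace p k (k - m) m := by
      refine ⟨fun x y h => ?_, fun x h => dif_neg h⟩
      have hxy : (p : ZMod (p ^ k)) ^ m ∣ x - y :=
        (pow_dvd_pow _ (by omega : m ≤ k - m)).trans h
      by_cases hy : (p : ZMod (p ^ k)) ^ m ∣ y
      · have hx : (p : ZMod (p ^ k)) ^ m ∣ x := (dvd_iff_dvd_of_dvd_sub hxy).mpr hy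
        obtain ⟨u, rfl⟩ := hx
        obtain ⟨v, rfl⟩ := hy
        rw [hψval, hψval]
        congr 2
        rw [← sub_eq_zero, ← map_sub]
        refine ZMod.castHom_eq_zero_of_mul_dvd ha hM hdvd ?_
        rw [← hb, mul_sub]
        simpa using h
      · have hx : ¬ (p : ZMod (p ^ k)) ^ m ∣ x := fun hx =>
          hy ((dvd_iff_dvd_of_dvd_sub hxy).mp hx)
        simp only [ψ, dif_neg hx, dif_neg hy]
    refine ⟨ψ, hψ, funext fun x => ?_⟩
    obtain ⟨x, rfl⟩ := ZMod.intCast_surjective x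
    rw [hT ψ hψ, hψval, map_intCast, mul_inv_cancel_left₀ hc0]
  · intro φ hφ ψ hψ a b
    funext x
    obtain ⟨x, rfl⟩ := ZMod.intCast_surjective x
    simp only [Pi.add_apply, Pi.smul_apply, smul_eq_mul, hT φ hφ, hT ψ hψ,
      hT _ (hlin φ hφ ψ hψ a b)]
    ring
  · intro φ hφ ψ hψ
    have hsum := ZMod.sum_eq_mul_sum_of_periodic ha hM
      (fun x => φ x * (starRingEnd ℂ) (ψ x))
      (fun x y h => by
        rw [← hb, Nat.cast_pow] at h
        simp only [hφ.1 x y h, hψ.1 x y h])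
      (fun x h => by
        rw [Nat.cast_pow] at h
        simp only [hφ.2 x h, zero_mul])
    have hval : ∀ ψ ∈ Sspace p k (k - m) m, ∀ i : ℕ, T ψ (i : ZMod (p ^ (k - 2 * m))) =
        c * ψ ((p : ZMod (p ^ k)) ^ m * (i : ZMod (p ^ k))) := fun ψ hψ i => by
      simpa using hT ψ hψ i
    have hpm : (p : ℂ) ^ m ≠ 0 := pow_ne_zero _ (Nat.cast_ne_zero.mpr hp.ne_zero)
    have hpN : (p : ℂ) ^ (k - 2 * m) ≠ 0 := pow_ne_zero _ (Nat.cast_ne_zero.mpr hp.ne_zero)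
    have hterm : ∀ z w : ℂ, c * z * (starRingEnd ℂ) (c * w) =
        ((p : ℂ) ^ m)⁻¹ * (z * (starRingEnd ℂ) w) := fun z w => by
      rw [map_mul, Complex.conj_ofReal, ← hcc]
      ring
    have hMC : ((p ^ k : ℕ) : ℂ) = (p : ℂ) ^ m * (p : ℂ) ^ (k - 2 * m) * (p : ℂ) ^ m := by
      rw [hM]; push_cast; rfl
    rw [inn, inn, hsum, ZMod.sum_eq_sum_fin, hMC]
    simp only [hval φ hφ, hval ψ hψ, hterm, ← Finset.mul_sum, Nat.cast_pow]
    field_simp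
end

section
/- Let p be an odd prime, let k, m be integers with 0 ≤ 2m ≤ k, let r be an integer, and let ψ ∈ S_k(k−m, m). Then for every integer x: p^{−(k+m)/2}·∑_{y ∈ ℤ/p^kℤ} ψ(y)·e(2·r·p^m·x·ỹ/p^k) = p^{−(k−2m)/2}·∑_{u ∈ ℤ/p^{k−2m}ℤ} p^{−m/2}·ψ(p^m·ũ)·e(2·r·x·ũ/p^{k−2m}), where ỹ, ũ ∈ ℤ are any representatives of y, u (both sides are independent of these choices). In other words, the map ψ ↦ (x ↦ p^{−m/2}·ψ(p^m·x)) intertwines the normalized Fourier-type transform with kernel e(2rxy/p^k) on level p^k with the one with kernel e(2rxy/p^{k−2m}) on level p^{k−2m}. -/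
theorem e_add_intCast (x : ℝ) (n : ℤ) : e (x + n) = e x := by
  unfold e
  rw [Complex.exp_eq_exp_iff_exists_int]
  exact ⟨n, by push_cast; ring⟩

theorem Function.Periodic.eq_of_intCast_zmod_eq {N : ℕ} {g : ℤ → ℂ}
    (hg : Function.Periodic g (N : ℤ)) {a b : ℤ} (h : (a : ZMod N) = b) : g a = g b := by
  rw [ZMod.intCast_eq_intCast_iff_dvd_sub] at h
  obtain ⟨c, hc⟩ := h
  have hb : b = a + c * N := by linarith
  rw [hb]
  exact (hg.int_mul c a).symm

/-- A periodic function may be summed over any system of representatives. -/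
theorem Function.Periodic.sum_zmod_eq_sum_range {N : ℕ} [NeZero N] {g : ℤ → ℂ}
    (hg : Function.Periodic g (N : ℤ)) (rep : ZMod N → ℤ)
    (hrep : ∀ y, ((rep y : ℤ) : ZMod N) = y) :
    ∑ y : ZMod N, g (rep y) = ∑ i ∈ Finset.range N, g i := by
  refine Finset.sum_bij (fun y _ => y.val) (fun y _ => Finset.mem_range.2 y.val_lt)
    (fun y _ z _ h => ZMod.val_injective N h)
    (fun i hi => ⟨(i : ZMod N), Finset.mem_univ _, ZMod.val_cast_of_lt (Finset.mem_range.1 hi)⟩)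
    (fun y _ => hg.eq_of_intCast_zmod_eq ?_)
  rw [hrep, Int.cast_natCast, ZMod.natCast_zmod_val]

theorem sum_range_mul_of_eq_zero_of_not_dvd {M : ℕ} (hM : 0 < M) (N : ℕ) (g : ℕ → ℂ)
    (hg : ∀ n, ¬ M ∣ n → g n = 0) :
    ∑ i ∈ Finset.range (M * N), g i = ∑ j ∈ Finset.range N, g (M * j) := by
  symm
  refine Finset.sum_of_injOn (fun j => M * j)
    (fun a _ b _ h => Nat.eq_of_mul_eq_mul_left hM h) ?_ ?_ (fun _ _ => rfl)
  · intro j hj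
    have hj : j < N := by simpa using hj
    simpa using (Nat.mul_lt_mul_left hM).2 hj
  · intro i hi hni
    refine hg i ?_
    rintro ⟨c, rfl⟩
    refine hni ⟨c, ?_, rfl⟩
    simpa using (Nat.mul_lt_mul_left hM).1 (Finset.mem_range.1 hi)

theorem Function.Periodic.sum_range_mul {N : ℕ} {g : ℕ → ℂ} (hg : Function.Periodic g N)
    (M : ℕ) : ∑ i ∈ Finset.range (M * N), g i = M * ∑ i ∈ Finset.range N, g i := by
  induction M with
  | zero => simp
  | succ M ih =>
    rw [Nat.succ_mul, Finset.sum_range_add, ih]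
    have h : ∀ i, g (M * N + i) = g i := fun i => by
      rw [add_comm]
      exact hg.nat_mul M i
    simp only [h]
    push_cast
    ring

theorem rpow_normalization {p : ℝ} (hp : 0 < p) (d m : ℕ) :
    (p ^ (2 * m + d + m)) ^ (-(1 / 2) : ℝ) * p ^ m =
      (p ^ d) ^ (-(1 / 2) : ℝ) * (p ^ m) ^ (-(1 / 2) : ℝ) := by
  simp only [← Real.rpow_natCast, ← Real.rpow_mul hp.le, ← Real.rpow_add hp]
  congr 1
  push_cast
  ring

theorem stmt3 (p : ℕ) [NeZero p] (hp : p.Prime) (hodd : Odd p) (k m : ℕ) (h2m : 2 * m ≤ k)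
    (r : ℤ) (ψ : ZMod (p ^ k) → ℂ) (hψ : ψ ∈ Sspace p k (k - m) m)
    (repk : ZMod (p ^ k) → ℤ) (hrepk : ∀ y, ((repk y : ℤ) : ZMod (p ^ k)) = y)
    (repm : ZMod (p ^ (k - 2 * m)) → ℤ)
    (hrepm : ∀ u, ((repm u : ℤ) : ZMod (p ^ (k - 2 * m))) = u) :
    ∀ x : ℤ,
      ((((p : ℝ) ^ (k + m)) ^ (-(1 / 2) : ℝ) : ℝ) : ℂ) *
          ∑ y : ZMod (p ^ k),
            ψ y * e (((2 * r * (p : ℤ) ^ m * x * repk y : ℤ) : ℝ) / (p : ℝ) ^ k) =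
        ((((p : ℝ) ^ (k - 2 * m)) ^ (-(1 / 2) : ℝ) : ℝ) : ℂ) *
          ∑ u : ZMod (p ^ (k - 2 * m)),
            ((((p : ℝ) ^ m) ^ (-(1 / 2) : ℝ) : ℝ) : ℂ) *
                ψ ((p : ZMod (p ^ k)) ^ m * ((repm u : ℤ) : ZMod (p ^ k))) *
              e (((2 * r * x * repm u : ℤ) : ℝ) / (p : ℝ) ^ (k - 2 * m)) := by
  intro x
  have hkm : k - m = m + (k - 2 * m) := by omega
  have hk : k = 2 * m + (k - 2 * m) := by omega
  rw [hkm] at hψ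
  generalize k - 2 * m = d at *
  obtain ⟨hper, hsupp⟩ := hψ
  have hp0 : (0 : ℝ) < p := by exact_mod_cast hp.pos
  let g : ℤ → ℂ := fun n =>
    ψ (n : ZMod (p ^ k)) * e (((2 * r * (p : ℤ) ^ m * x * n : ℤ) : ℝ) / (p : ℝ) ^ k)
  let h : ℤ → ℂ := fun n =>
    ψ ((p : ZMod (p ^ k)) ^ m * (n : ZMod (p ^ k))) *
      e (((2 * r * x * n : ℤ) : ℝ) / (p : ℝ) ^ d)
  have hg : Function.Periodic g ((p ^ k : ℕ) : ℤ) := by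
    intro n
    have h1 : ((n + ((p ^ k : ℕ) : ℤ) : ℤ) : ZMod (p ^ k)) = n := by
      rw [Int.cast_add, Int.cast_natCast, ZMod.natCast_self, add_zero]
    have h2 : ((2 * r * (p : ℤ) ^ m * x * (n + ((p ^ k : ℕ) : ℤ)) : ℤ) : ℝ) / (p : ℝ) ^ k =
        ((2 * r * (p : ℤ) ^ m * x * n : ℤ) : ℝ) / (p : ℝ) ^ k +
          ((2 * r * (p : ℤ) ^ m * x : ℤ) : ℝ) := by
      push_cast
      field_simp
    simp only [g, h1, h2, e_add_intCast]
  have hh : Function.Periodic h ((p ^ d : ℕ) : ℤ) := by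
    intro n
    have h1 : ψ ((p : ZMod (p ^ k)) ^ m * ((n + ((p ^ d : ℕ) : ℤ) : ℤ) : ZMod (p ^ k))) =
        ψ ((p : ZMod (p ^ k)) ^ m * (n : ZMod (p ^ k))) := by
      refine hper _ _ ⟨1, ?_⟩
      push_cast
      ring
    have h2 : ((2 * r * x * (n + ((p ^ d : ℕ) : ℤ)) : ℤ) : ℝ) / (p : ℝ) ^ d =
        ((2 * r * x * n : ℤ) : ℝ) / (p : ℝ) ^ d + ((2 * r * x : ℤ) : ℝ) := by
      push_cast
      field_simp
    simp only [h, h1, h2, e_add_intCast]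
  have hgh : ∀ n : ℤ, g ((p : ℤ) ^ m * n) = h n := by
    intro n
    have h2 : ((2 * r * (p : ℤ) ^ m * x * ((p : ℤ) ^ m * n) : ℤ) : ℝ) / (p : ℝ) ^ k =
        ((2 * r * x * n : ℤ) : ℝ) / (p : ℝ) ^ d := by
      have hpow : (p : ℝ) ^ k = (p : ℝ) ^ m * (p : ℝ) ^ m * (p : ℝ) ^ d := by rw [hk]; ring
      rw [hpow]
      push_cast
      field_simp
    simp only [g, h, h2]
    push_cast
    rfl
  have hg0 : ∀ n : ℕ, ¬ p ^ m ∣ n → g n = 0 := by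
    intro n hn
    have : ψ (n : ZMod (p ^ k)) = 0 := by
      refine hsupp _ fun hdvd => hn ?_
      have hdvd_pow : p ^ m ∣ p ^ k := pow_dvd_pow p (by omega)
      have := map_dvd (ZMod.castHom hdvd_pow (ZMod (p ^ m))) hdvd
      rw [map_pow, map_natCast, map_natCast, ← Nat.cast_pow, ZMod.natCast_self,
        zero_dvd_iff] at this
      exact (ZMod.natCast_eq_zero_iff _ _).1 this
    simp only [g, Int.cast_natCast, this, zero_mul]
  have hsum : ∑ y : ZMod (p ^ k), g (repk y) =
      (p : ℂ) ^ m * ∑ u : ZMod (p ^ d), h (repm u) := by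
    have hpk : p ^ k = p ^ m * (p ^ m * p ^ d) := by rw [hk]; ring
    rw [hg.sum_zmod_eq_sum_range repk hrepk, hh.sum_zmod_eq_sum_range repm hrepm, hpk,
      sum_range_mul_of_eq_zero_of_not_dvd (pow_pos hp.pos m) _ (fun n => g n) hg0,
      ← Nat.cast_pow,
      ← Function.Periodic.sum_range_mul (g := fun n : ℕ => h n) (fun n => by
        simpa using hh n)]
    refine Finset.sum_congr rfl fun j _ => ?_
    rw [← hgh]
    push_cast
    rfl
  have hL : ∑ y : ZMod (p ^ k),
      ψ y * e (((2 * r * (p : ℤ) ^ m * x * repk y : ℤ) : ℝ) / (p : ℝ) ^ k) =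
      ∑ y : ZMod (p ^ k), g (repk y) := by
    simp only [g, hrepk]
  rw [hL, hsum]
  simp only [mul_assoc _ (ψ _) _, ← Finset.mul_sum]
  rw [← mul_assoc, ← mul_assoc]
  congr 1
  rw [hk]
  exact_mod_cast rpow_normalization hp0 d m
end

section
/- Let p > 3 be a prime, k ≥ 1 an integer, N = p^{2k}, and let r be an integer with 2r ≡ 1 (mod N). Let x1, x2 be integers. Then: (1) for every integer b and every y ∈ ℤ/Nℤ, e(r·b·ỹ²/N)·ζ_{(x1,x2)}(y) = e(r·b·x2²/N)·ζ_{(x1+b·x2, x2)}(y), where ỹ ∈ ℤ is any representative of y (the value is independent of this choice); (2) for all integers s, s' with s·s' ≡ 1 (mod N) and every y ∈ ℤ/Nℤ, ζ_{(x1,x2)}(s·y) = ζ_{(s·x1, s'·x2)}(y). -/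
theorem e_intCast (m : ℤ) : e m = 1 := by
  rw [e, ← Complex.exp_int_mul_two_pi_mul_I m]
  push_cast
  ring_nf

/-- `e (a / n)` depends only on `a` modulo `n`. -/
theorem e_div_eq_of_dvd_sub {n : ℝ} (hn : n ≠ 0) {a b m : ℤ} (h : (a : ℝ) = b + n * m) :
    e (a / n) = e (b / n) := by
  have : (a : ℝ) / n = b / n + m := by
    rw [h]
    field_simp
  rw [this, e_add, e_intCast, mul_one]

theorem stmt7 (p k : ℕ) [NeZero p] (hp : p.Prime) (hp3 : 3 < p) (hk : 1 ≤ k)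
    (r : ℤ) (hr : ((2 * r : ℤ) : ZMod (p ^ (2 * k))) = 1)
    -- `ζ x1 x2` is the function `ζ_{(x1,x2)} : ℤ/Nℤ → ℂ`, `N = p^{2k}`, characterized by:
    (ζ : ℤ → ℤ → ZMod (p ^ (2 * k)) → ℂ)
    (hζ : ∀ x1 x2 t : ℤ,
      ζ x1 x2 ((x2 : ZMod (p ^ (2 * k))) +
          (p : ZMod (p ^ (2 * k))) ^ k * ((t : ℤ) : ZMod (p ^ (2 * k)))) =
        e (((x1 * t : ℤ) : ℝ) / (p : ℝ) ^ k))
    (hζ0 : ∀ x1 x2 : ℤ, ∀ y : ZMod (p ^ (2 * k)),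
      (¬ ∃ t : ℤ, y = (x2 : ZMod (p ^ (2 * k))) +
          (p : ZMod (p ^ (2 * k))) ^ k * ((t : ℤ) : ZMod (p ^ (2 * k)))) → ζ x1 x2 y = 0)
    (x1 x2 : ℤ)
    (rep : ZMod (p ^ (2 * k)) → ℤ) (hrep : ∀ y, ((rep y : ℤ) : ZMod (p ^ (2 * k))) = y) :
    (∀ b : ℤ, ∀ y : ZMod (p ^ (2 * k)),
      e (((r * b * (rep y) ^ 2 : ℤ) : ℝ) / (p : ℝ) ^ (2 * k)) * ζ x1 x2 y =
        e (((r * b * x2 ^ 2 : ℤ) : ℝ) / (p : ℝ) ^ (2 * k)) * ζ (x1 + b * x2) x2 y) ∧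
    (∀ s s' : ℤ, ((s * s' : ℤ) : ZMod (p ^ (2 * k))) = 1 → ∀ y : ZMod (p ^ (2 * k)),
      ζ x1 x2 ((s : ZMod (p ^ (2 * k))) * y) = ζ (s * x1) (s' * x2) y) := by
  have hp0 : (p : ℝ) ≠ 0 := Nat.cast_ne_zero.mpr hp.ne_zero
  have hdvd (a b : ℤ) (h : (a : ZMod (p ^ (2 * k))) = b) : ∃ m : ℤ, a = b + (p : ℤ) ^ (2 * k) * m := by
    obtain ⟨m, hm⟩ := (ZMod.intCast_eq_intCast_iff_dvd_sub b a _).mp h.symm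
    push_cast at hm
    exact ⟨m, by linarith⟩
  refine ⟨fun b y => ?_, fun s s' hs y => ?_⟩
  · by_cases hy : ∃ t : ℤ, y = (x2 : ZMod (p ^ (2 * k))) +
        (p : ZMod (p ^ (2 * k))) ^ k * ((t : ℤ) : ZMod (p ^ (2 * k)))
    · obtain ⟨t, ht⟩ := hy
      obtain ⟨m, hm⟩ := hdvd (rep y) (x2 + p ^ k * t) (by rw [hrep, ht]; push_cast; rfl)
      obtain ⟨n, hn⟩ := hdvd (2 * r) 1 (by rw [hr, Int.cast_one])
      have key : e (((r * b * (rep y) ^ 2 : ℤ) : ℝ) / (p : ℝ) ^ (2 * k)) =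
          e (((r * b * x2 ^ 2 + b * x2 * t * p ^ k : ℤ) : ℝ) / (p : ℝ) ^ (2 * k)) := by
        refine e_div_eq_of_dvd_sub (pow_ne_zero _ hp0)
          (m := n * b * x2 * t * p ^ k + r * b * t ^ 2 + r * b * m * (2 * (x2 + p ^ k * t)
            + p ^ (2 * k) * m)) ?_
        have : r * b * (rep y) ^ 2 = (r * b * x2 ^ 2 + b * x2 * t * p ^ k) + (p : ℤ) ^ (2 * k) *
            (n * b * x2 * t * p ^ k + r * b * t ^ 2 + r * b * m * (2 * (x2 + p ^ k * t)
              + p ^ (2 * k) * m)) := by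
          rw [hm]
          linear_combination (b * x2 * t * (p : ℤ) ^ k) * hn
        exact_mod_cast this
      have hsplit : ((r * b * x2 ^ 2 + b * x2 * t * p ^ k : ℤ) : ℝ) / (p : ℝ) ^ (2 * k) =
          ((r * b * x2 ^ 2 : ℤ) : ℝ) / (p : ℝ) ^ (2 * k) + ((b * x2 * t : ℤ) : ℝ) / (p : ℝ) ^ k := by
        push_cast
        rw [two_mul, pow_add]
        field_simp
      rw [key, hsplit, ht, hζ, hζ, e_add, mul_assoc, ← e_add]
      congr 2
      push_cast
      ring
    · rw [hζ0 _ _ _ hy, hζ0 _ _ _ hy, mul_zero, mul_zero]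
  · have hs1 : (s : ZMod (p ^ (2 * k))) * s' = 1 := by exact_mod_cast hs
    by_cases hy : ∃ t : ℤ, y = ((s' * x2 : ℤ) : ZMod (p ^ (2 * k))) +
        (p : ZMod (p ^ (2 * k))) ^ k * ((t : ℤ) : ZMod (p ^ (2 * k)))
    · obtain ⟨t, ht⟩ := hy
      have hsy : s * y = (x2 : ZMod (p ^ (2 * k))) +
          (p : ZMod (p ^ (2 * k))) ^ k * ((s * t : ℤ) : ZMod (p ^ (2 * k))) := by
        rw [ht]
        push_cast
        linear_combination (x2 : ZMod (p ^ (2 * k))) * hs1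
      rw [hsy, ht, hζ, hζ]
      congr 3
      ring
    · rw [hζ0 _ _ _ hy]
      refine hζ0 _ _ _ fun ⟨t, ht⟩ => hy ⟨s' * t, ?_⟩
      push_cast
      linear_combination (s' : ZMod (p ^ (2 * k))) * ht - y * hs1
end

section
/- Let p > 3 be a prime, k ≥ 1 an integer, N = p^{2k}, and let r be an integer with 2r ≡ 1 (mod N). Let t, D, x1, x2 be integers and set x1' = x1 + t·p^k·D·x2 and x2' = t·p^k·x1 + x2. Then, as functions on ℤ/Nℤ, e(r·(x1'·x2' − x1·x2)/N)·ζ_{(x1',x2')} = e(−r·(x1² − D·x2²)·t/p^k)·ζ_{(x1,x2)}. -/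
theorem e_mul_e_eq_of_add_eq {a b c d : ℝ} (m : ℤ) (h : a + b = c + d + m) :
    e a * e b = e c * e d := by
  unfold e
  rw [← Complex.exp_add, ← Complex.exp_add, Complex.exp_eq_exp_iff_exists_int]
  refine ⟨m, ?_⟩
  have h' : (a : ℂ) + b = c + d + m := by exact_mod_cast h
  linear_combination (2 * Real.pi * Complex.I) * h'


theorem stmt9 (p k : ℕ) [NeZero p] (hp : p.Prime) (hp3 : 3 < p) (hk : 1 ≤ k)
    (r : ℤ) (hr : ((2 * r : ℤ) : ZMod (p ^ (2 * k))) = 1)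
    -- `ζ x1 x2` is the function `ζ_{(x1,x2)} : ℤ/Nℤ → ℂ`, `N = p^{2k}`, characterized by:
    (ζ : ℤ → ℤ → ZMod (p ^ (2 * k)) → ℂ)
    (hζ : ∀ x1 x2 t : ℤ,
      ζ x1 x2 ((x2 : ZMod (p ^ (2 * k))) +
          (p : ZMod (p ^ (2 * k))) ^ k * ((t : ℤ) : ZMod (p ^ (2 * k)))) =
        e (((x1 * t : ℤ) : ℝ) / (p : ℝ) ^ k))
    (hζ0 : ∀ x1 x2 : ℤ, ∀ y : ZMod (p ^ (2 * k)),
      (¬ ∃ t : ℤ, y = (x2 : ZMod (p ^ (2 * k))) +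
          (p : ZMod (p ^ (2 * k))) ^ k * ((t : ℤ) : ZMod (p ^ (2 * k)))) → ζ x1 x2 y = 0)
    (t D x1 x2 x1' x2' : ℤ)
    (hx1' : x1' = x1 + t * (p : ℤ) ^ k * D * x2)
    (hx2' : x2' = t * (p : ℤ) ^ k * x1 + x2) :
    ∀ y : ZMod (p ^ (2 * k)),
      e (((r * (x1' * x2' - x1 * x2) : ℤ) : ℝ) / (p : ℝ) ^ (2 * k)) * ζ x1' x2' y =
        e (((-(r * (x1 ^ 2 - D * x2 ^ 2) * t) : ℤ) : ℝ) / (p : ℝ) ^ k) * ζ x1 x2 y := by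
  intro y
  have hp0 : (p : ℝ) ^ k ≠ 0 := pow_ne_zero _ (Nat.cast_ne_zero.mpr hp.ne_zero)
  by_cases hy : ∃ s : ℤ, y = (x2 : ZMod (p ^ (2 * k))) +
      (p : ZMod (p ^ (2 * k))) ^ k * ((s : ℤ) : ZMod (p ^ (2 * k)))
  · obtain ⟨s, hs⟩ := hy
    have hs' : y = (x2' : ZMod (p ^ (2 * k))) +
        (p : ZMod (p ^ (2 * k))) ^ k * ((s - t * x1 : ℤ) : ZMod (p ^ (2 * k))) := by
      rw [hs, hx2']
      push_cast
      ring
    have hL := hζ x1' x2' (s - t * x1)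
    rw [← hs'] at hL
    have hR := hζ x1 x2 s
    rw [← hs] at hR
    rw [hL, hR]
    obtain ⟨n, hn⟩ : ((p ^ (2 * k) : ℕ) : ℤ) ∣ 2 * r - 1 := by
      rw [← ZMod.intCast_zmod_eq_zero_iff_dvd, Int.cast_sub, hr, Int.cast_one, sub_self]
    have hnR : 2 * (r : ℝ) - 1 = ((p : ℝ) ^ k) ^ 2 * n := by
      rw [← pow_mul, mul_comm k 2]
      exact_mod_cast hn
    refine e_mul_e_eq_of_add_eq
      (r * t ^ 2 * D * x1 * x2 + t * D * x2 * (s - t * x1) + p ^ k * n * t * x1 ^ 2) ?_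
    rw [hx1', hx2', mul_comm 2 k, pow_mul]
    push_cast
    generalize (p : ℝ) ^ k = P at *
    field_simp
    linear_combination (P * t * x1 ^ 2 : ℝ) * hnR
  · have hy' : ¬ ∃ s : ℤ, y = (x2' : ZMod (p ^ (2 * k))) +
        (p : ZMod (p ^ (2 * k))) ^ k * ((s : ℤ) : ZMod (p ^ (2 * k))) := by
      rintro ⟨s, hs⟩
      refine hy ⟨s + t * x1, ?_⟩
      rw [hs, hx2']
      push_cast
      ring
    rw [hζ0 x1' x2' y hy', hζ0 x1 x2 y hy, mul_zero, mul_zero]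
end

section
/- Let p > 3 be a prime, k ≥ 1 an integer, and let C, D ∈ ℤ/p^kℤ both be units. Then the number of pairs (x, y) ∈ (ℤ/p^kℤ)² satisfying x² − D·y² = −C equals p^k − (D/p)·p^{k−1}, where (D/p) ∈ {1, −1} is the Legendre symbol modulo p of (any representative of) D. -/
open Finset in
/-- The fibres of a surjective homomorphism of finite additive groups all have the same size. -/
lemma card_fiber_mul_card {R F : Type*} [AddGroup R] [Fintype R] [AddGroup F] [Fintype F]
    [DecidableEq F] (f : R →+ F) (hf : Function.Surjective f) (a : F) :
    #{x | f x = a} * Fintype.card F = Fintype.card R := by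
  have h (b : F) : #{x | f x = b} = #{x | f x = a} := by
    obtain ⟨r, hr⟩ := hf (-b + a)
    refine card_bij' (fun x _ ↦ x + r) (fun x _ ↦ x - r) ?_ ?_ (by simp) (by simp) <;>
      simp +contextual [hr]
  rw [← card_univ (α := R), card_eq_sum_card_fiberwise (s := univ) (f := f) (t := univ) (by simp),
    sum_congr rfl fun b _ ↦ h b, sum_const, smul_eq_mul, card_univ, mul_comm]

/-- Squaring is a bijection between the fibres of `f` over `a` and over `a ^ 2`. -/
lemma existsUnique_sq_eq_of_map_eq {R F : Type*} [CommRing R] [Fintype R] [Field F] [Fintype F]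
    (f : R →+* F) [IsLocalHom f] (hf : Function.Surjective f) (h2 : (2 : F) ≠ 0)
    {a : F} (ha : a ≠ 0) {z : R} (hz : f z = a ^ 2) :
    ∃! x, f x = a ∧ x ^ 2 = z := by
  classical
  have hinj : ∀ x y, f x = a → f y = a → x ^ 2 = y ^ 2 → x = y := by
    intro x y hx hy h
    have hu : IsUnit (x + y) := by
      refine isUnit_of_map_unit f _ (isUnit_iff_ne_zero.mpr ?_)
      rw [map_add, hx, hy, ← two_mul]
      exact mul_ne_zero h2 ha
    have h0 : (x + y) * (x - y) = (x + y) * 0 := by linear_combination h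
    exact sub_eq_zero.mp (hu.mul_left_cancel h0)
  have hcard : (Finset.univ.filter fun x ↦ f x = a).card =
      (Finset.univ.filter fun x ↦ f x = a ^ 2).card :=
    Nat.eq_of_mul_eq_mul_right Fintype.card_pos
      ((card_fiber_mul_card f.toAddMonoidHom hf a).trans
        (card_fiber_mul_card f.toAddMonoidHom hf (a ^ 2)).symm)
  obtain ⟨x, hx, hxz⟩ := Finset.surj_on_of_inj_on_of_card_le
    (s := Finset.univ.filter fun x ↦ f x = a) (t := Finset.univ.filter fun x ↦ f x = a ^ 2)
    (fun x _ ↦ x ^ 2) (fun x hx ↦ by simp_all)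
    (fun x y hx hy h ↦ hinj x y (by simpa using hx) (by simpa using hy) h) hcard.ge z
    (by simpa using hz)
  have hx' : f x = a := by simpa using hx
  exact ⟨x, ⟨hx', hxz.symm⟩, fun y hy ↦ hinj y x hy.1 hx' (hy.2.trans hxz)⟩

open Finset in
/-- Every point of the reduced conic `x ^ 2 - D * y ^ 2 = -C` lifts in as many ways as there are
elements of a fibre of the reduction. -/
lemma card_conic_fiber {R F : Type*} [CommRing R] [Fintype R] [DecidableEq R] [Field F] [Fintype F]
    [DecidableEq F] (f : R →+* F) [IsLocalHom f] (hf : Function.Surjective f) (h2 : (2 : F) ≠ 0)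
    {C D : R} (hC : IsUnit C) (hD : IsUnit D) {a b : F} (hab : a ^ 2 - f D * b ^ 2 = -f C) :
    #{xy : R × R | xy.1 ^ 2 - D * xy.2 ^ 2 = -C ∧ f xy.1 = a ∧ f xy.2 = b} * Fintype.card F =
      Fintype.card R := by
  by_cases ha : a = 0
  · have hb : b ≠ 0 := by
      rintro rfl
      have := (hC.map f).ne_zero
      simp_all
    obtain ⟨d, hd⟩ := hD.exists_right_inv
    have hd' : f D * f d = 1 := by rw [← map_mul, hd, map_one]
    rw [← card_fiber_mul_card f.toAddMonoidHom hf a]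
    congr 1
    refine card_bij (fun xy _ ↦ xy.1) (by simp +contextual) ?_ ?_
    · rintro ⟨x, y⟩ h ⟨x', y'⟩ h' rfl
      simp only [mem_filter, mem_univ, true_and] at h h'
      have hz : f (y ^ 2) = b ^ 2 := by rw [map_pow, h.2.2]
      rw [(existsUnique_sq_eq_of_map_eq f hf h2 hb hz).unique ⟨h.2.2, rfl⟩ ⟨h'.2.2, by
        linear_combination d * h.1 - d * h'.1 + (y ^ 2 - y' ^ 2) * hd⟩]
    · intro x hx
      replace hx : f x = a := by simpa using hx
      obtain ⟨y, ⟨hy, hyz⟩, -⟩ := existsUnique_sq_eq_of_map_eq f hf h2 hb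
        (z := d * (x ^ 2 + C)) (by
          simp only [map_mul, map_add, map_pow, hx]
          linear_combination f d * hab + b ^ 2 * hd')
      refine ⟨(x, y), ?_, rfl⟩
      simp only [mem_filter, mem_univ, true_and]
      exact ⟨by linear_combination -D * hyz - (x ^ 2 + C) * hd, hx, hy⟩
  · rw [← card_fiber_mul_card f.toAddMonoidHom hf b]
    congr 1
    refine card_bij (fun xy _ ↦ xy.2) (by simp +contextual) ?_ ?_
    · rintro ⟨x, y⟩ h ⟨x', y'⟩ h' rfl
      simp only [mem_filter, mem_univ, true_and] at h h'
      have hz : f (x ^ 2) = a ^ 2 := by rw [map_pow, h.2.1]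
      rw [(existsUnique_sq_eq_of_map_eq f hf h2 ha hz).unique ⟨h.2.1, rfl⟩ ⟨h'.2.1, by
        linear_combination h'.1 - h.1⟩]
    · intro y hy
      replace hy : f y = b := by simpa using hy
      obtain ⟨x, ⟨hx, hxz⟩, -⟩ := existsUnique_sq_eq_of_map_eq f hf h2 ha
        (z := D * y ^ 2 - C) (by
          simp only [map_mul, map_sub, map_pow, hy]
          linear_combination -hab)
      refine ⟨(x, y), ?_, rfl⟩
      simp only [mem_filter, mem_univ, true_and]
      exact ⟨by linear_combination hxz, hx, hy⟩

open Finset in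
lemma card_conic_mul_card {R F : Type*} [CommRing R] [Fintype R] [DecidableEq R] [Field F]
    [Fintype F] [DecidableEq F] (f : R →+* F) [IsLocalHom f] (hf : Function.Surjective f)
    (h2 : (2 : F) ≠ 0) {C D : R} (hC : IsUnit C) (hD : IsUnit D) :
    #{xy : R × R | xy.1 ^ 2 - D * xy.2 ^ 2 = -C} * Fintype.card F =
      #{ab : F × F | ab.1 ^ 2 - f D * ab.2 ^ 2 = -f C} * Fintype.card R := by
  rw [card_eq_sum_card_fiberwise (f := Prod.map f f)
    (t := ({ab : F × F | ab.1 ^ 2 - f D * ab.2 ^ 2 = -f C} : Finset (F × F))), sum_mul]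
  · refine sum_const_nat fun ab hab ↦ ?_
    rw [← card_conic_fiber f hf h2 hC hD (mem_filter.mp hab).2, filter_filter]
    simp only [Prod.ext_iff, Prod.map_fst, Prod.map_snd]
  · intro xy h
    replace h : xy.1 ^ 2 - D * xy.2 ^ 2 = -C := by simpa using h
    simpa using congrArg f h

section Field

variable {F : Type*} [Field F] [Fintype F] [DecidableEq F]

lemma sum_quadraticChar_mul_quadraticChar_add (hF : ringChar F ≠ 2) {C : F} (hC : C ≠ 0) :
    ∑ u : F, quadraticChar F u * quadraticChar F (u + C) = -1 := by
  have hJ := jacobiSum_nontrivial_inv (quadraticChar_ne_one hF)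
  rw [(quadraticChar_isQuadratic F).inv, jacobiSum] at hJ
  rw [← Equiv.sum_comp (Equiv.mulLeft₀ (-C) (neg_ne_zero.mpr hC))]
  have h (t : F) : quadraticChar F (-C * t) * quadraticChar F (-C * t + C) =
      quadraticChar F (-1) * (quadraticChar F t * quadraticChar F (1 - t)) := by
    rw [show -C * t + C = C * (1 - t) by ring, show -C * t = -1 * C * t by ring]
    simp only [map_mul]
    linear_combination quadraticChar F (-1) * quadraticChar F t * quadraticChar F (1 - t) *
      quadraticChar_sq_one hC
  simp only [Equiv.mulLeft₀_apply, h, ← Finset.mul_sum, hJ]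
  linear_combination -quadraticChar_sq_one (neg_ne_zero.mpr (one_ne_zero (α := F)))

open Finset in
lemma card_conic (hF : ringChar F ≠ 2) {C D : F} (hC : C ≠ 0) (hD : D ≠ 0) :
    (#{xy : F × F | xy.1 ^ 2 - D * xy.2 ^ 2 = -C} : ℤ) =
      Fintype.card F - quadraticChar F D := by
  have hfib (u : F) : (#{xy ∈ ({xy : F × F | xy.1 ^ 2 - D * xy.2 ^ 2 = -C} : Finset (F × F)) |
      xy.1 ^ 2 = u} : ℤ) =
      (quadraticChar F u + 1) * (quadraticChar F D * quadraticChar F (u + C) + 1) := by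
    have h : quadraticChar F D * quadraticChar F (u + C) = quadraticChar F ((u + C) / D) := by
      have := quadraticChar_sq_one hD
      rw [show u + C = D * ((u + C) / D) by field_simp, map_mul, mul_div_cancel_left₀ _ hD]
      linear_combination quadraticChar F ((u + C) / D) * this
    rw [h, ← quadraticChar_card_sqrts hF, ← quadraticChar_card_sqrts hF, ← Nat.cast_mul,
      ← card_product]
    congr 2
    ext ⟨x, y⟩
    simp only [filter_filter, mem_filter, mem_univ, true_and, mem_product, Set.mem_toFinset,
      Set.mem_ofPred_eq, eq_div_iff hD]
    constructor
    · rintro ⟨hxy, rfl⟩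
      exact ⟨rfl, by linear_combination -hxy⟩
    · rintro ⟨rfl, hxy⟩
      exact ⟨by linear_combination -hxy, rfl⟩
  rw [card_eq_sum_card_fiberwise (f := fun xy ↦ xy.1 ^ 2) (t := univ) (by simp)]
  push_cast
  simp only [hfib]
  have hshift : ∑ u : F, quadraticChar F (u + C) = 0 := by
    rw [← quadraticChar_sum_zero hF, ← Equiv.sum_comp (Equiv.addRight C) (quadraticChar F ·)]
    rfl
  calc ∑ u : F, (quadraticChar F u + 1) * (quadraticChar F D * quadraticChar F (u + C) + 1)
      = ∑ u : F, (quadraticChar F D * (quadraticChar F u * quadraticChar F (u + C)) +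
          quadraticChar F u + quadraticChar F D * quadraticChar F (u + C) + 1) :=
        sum_congr rfl fun _ _ ↦ by ring
    _ = Fintype.card F - quadraticChar F D := by
        simp only [sum_add_distrib, ← mul_sum, sum_quadraticChar_mul_quadraticChar_add hF hC,
          quadraticChar_sum_zero hF, hshift]
        simp
        ring

end Field

lemma isLocalHom_castHom_prime_pow (p : ℕ) [Fact p.Prime] {k : ℕ} (hk : k ≠ 0) :
    IsLocalHom (ZMod.castHom (dvd_pow_self p hk) (ZMod p)) where
  map_nonunit a h := by
    have : NeZero (p ^ k) := ⟨pow_ne_zero k (Fact.out : p.Prime).ne_zero⟩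
    rw [← ZMod.natCast_zmod_val a, map_natCast, ZMod.isUnit_iff_coprime] at h
    rw [← ZMod.natCast_zmod_val a, ZMod.isUnit_iff_coprime]
    exact h.pow_right k

theorem stmt10 (p k : ℕ) [NeZero p] [Fact p.Prime] (hp3 : 3 < p) (hk : 1 ≤ k)
    (C D : ZMod (p ^ k)) (hC : IsUnit C) (hD : IsUnit D) :
    (((Finset.univ.filter fun xy : ZMod (p ^ k) × ZMod (p ^ k) =>
          xy.1 ^ 2 - D * xy.2 ^ 2 = -C).card : ℤ)) =
      (p : ℤ) ^ k - legendreSym p (D.val : ℤ) * (p : ℤ) ^ (k - 1) := by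
  have hk0 : k ≠ 0 := by omega
  have hF : ringChar (ZMod p) ≠ 2 := by
    rw [ZMod.ringChar_zmod_n]
    omega
  set f := ZMod.castHom (dvd_pow_self p hk0) (ZMod p)
  have : IsLocalHom f := isLocalHom_castHom_prime_pow p hk0
  have hfD : f D = ((D.val : ℤ) : ZMod p) := by
    conv_lhs => rw [← ZMod.natCast_zmod_val D, map_natCast]
    simp
  have hlift := card_conic_mul_card f (ZMod.castHom_surjective (dvd_pow_self p hk0))
    (Ring.two_ne_zero hF) hC hD
  have hcard := card_conic hF (hC.map f).ne_zero (hD.map f).ne_zero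
  rw [ZMod.card] at hcard
  rw [ZMod.card, ZMod.card] at hlift
  have hp0 : (p : ℤ) ≠ 0 := by exact_mod_cast NeZero.ne p
  refine mul_right_cancel₀ hp0 ?_
  rw [legendreSym, ← hfD, sub_mul, mul_assoc, ← pow_succ _ (k - 1), Nat.sub_add_cancel hk]
  zify at hlift
  rw [hlift, hcard]
  ring
end

section
/- Let p > 3 be a prime, k ≥ 1 an integer, and let D ∈ ℤ/p^kℤ be arbitrary and C ∈ ℤ/p^kℤ a unit. Suppose x1, x2, y1, y2 ∈ ℤ/p^kℤ satisfy x1² − D·x2² = −C and y1² − D·y2² = −C. Then there exist a, b ∈ ℤ/p^kℤ with a² − D·b² = 1 such that y1 = a·x1 + D·b·x2 and y2 = b·x1 + a·x2. (That is, the group H_D of matrices [[a, bD],[b, a]] with a² − Db² = 1 acts transitively on the solution set of x1² − D·x2² = −C when C is a unit.) -/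
theorem stmt11 (p k : ℕ) (hp : p.Prime) (hp3 : 3 < p) (hk : 1 ≤ k)
    (C D : ZMod (p ^ k)) (hC : IsUnit C)
    (x1 x2 y1 y2 : ZMod (p ^ k))
    (hx : x1 ^ 2 - D * x2 ^ 2 = -C) (hy : y1 ^ 2 - D * y2 ^ 2 = -C) :
    ∃ a b : ZMod (p ^ k), a ^ 2 - D * b ^ 2 = 1 ∧
      y1 = a * x1 + D * b * x2 ∧ y2 = b * x1 + a * x2 := by
  obtain ⟨u, hu⟩ := hC.exists_right_inv
  refine ⟨-u * (y1 * x1 - D * y2 * x2), -u * (y2 * x1 - y1 * x2), ?_, ?_, ?_⟩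
  · linear_combination u ^ 2 * (y1 ^ 2 - D * y2 ^ 2) * hx - u ^ 2 * C * hy + (C * u + 1) * hu
  · linear_combination u * y1 * hx - y1 * hu
  · linear_combination u * y2 * hx - y2 * hu
end

section
/- Let p > 3 be a prime, k ≥ 1 an integer, let d ∈ ℤ/p^kℤ be a unit, and set D = d². Suppose x1, x2, y1, y2 ∈ ℤ/p^kℤ satisfy x1² − D·x2² = y1² − D·y2², x1 ≡ d·x2 (mod p), y1 ≡ d·y2 (mod p), and x1 and y1 are units. Then there exist a, b ∈ ℤ/p^kℤ with a² − D·b² = 1 such that y1 = a·x1 + D·b·x2 and y2 = b·x1 + a·x2. (Here the common value −C = x1² − D·x2² is allowed to be divisible by p, or even zero.) -/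
/-- Over a commutative ring in which `2` and `d` are invertible, two points on the same level set of
`x₁² - d² x₂²` with `x₁ + d x₂` invertible differ by an element of the norm-one group. -/
theorem exists_norm_one_of_isUnit_add {R : Type*} [CommRing R] {d x1 x2 y1 y2 : R}
    (h2 : IsUnit (2 : R)) (hd : IsUnit d)
    (hN : x1 ^ 2 - d ^ 2 * x2 ^ 2 = y1 ^ 2 - d ^ 2 * y2 ^ 2)
    (hx : IsUnit (x1 + d * x2)) (hy : IsUnit (y1 + d * y2)) :
    ∃ a b : R, a ^ 2 - d ^ 2 * b ^ 2 = 1 ∧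
      y1 = a * x1 + d ^ 2 * b * x2 ∧ y2 = b * x1 + a * x2 := by
  obtain ⟨i, hi⟩ := h2.exists_right_inv
  obtain ⟨e, he⟩ := hd.exists_right_inv
  obtain ⟨w, hw⟩ := hx.exists_right_inv
  obtain ⟨z, hz⟩ := hy.exists_right_inv
  obtain ⟨s, hs⟩ : ∃ s, s = (y1 + d * y2) * w := ⟨_, rfl⟩
  obtain ⟨t, ht⟩ : ∃ t, t = (x1 + d * x2) * z := ⟨_, rfl⟩
  have hst : s * t = 1 := by
    rw [hs, ht]; linear_combination (y1 + d * y2) * z * hw + hz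
  have hsx : s * (x1 + d * x2) = y1 + d * y2 := by
    rw [hs]; linear_combination (y1 + d * y2) * hw
  have htx : t * (x1 - d * x2) = y1 - d * y2 := by
    rw [ht]; linear_combination z * hN + (y1 - d * y2) * hz
  obtain ⟨a, ha⟩ : ∃ a, a = i * (s + t) := ⟨_, rfl⟩
  obtain ⟨b, hb⟩ : ∃ b, b = i * e * (s - t) := ⟨_, rfl⟩
  have hdb : d * b = i * (s - t) := by
    rw [hb]; linear_combination i * (s - t) * he
  have hadd : a + d * b = s := by
    rw [hdb, ha]; linear_combination s * hi
  have hsub : a - d * b = t := by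
    rw [hdb, ha]; linear_combination t * hi
  rw [← hadd] at hst hsx
  rw [← hsub] at hst htx
  refine ⟨a, b, by linear_combination hst, h2.mul_left_cancel ?_,
    (h2.mul hd).mul_left_cancel ?_⟩
  · linear_combination -hsx - htx
  · linear_combination htx - hsx

/-- If `x - y` is nilpotent and `2`, `x` are invertible, then `x + y` is invertible. -/
theorem isUnit_add_of_isNilpotent_sub {R : Type*} [CommRing R] {x y : R}
    (h2 : IsUnit (2 : R)) (hx : IsUnit x) (h : IsNilpotent (x - y)) : IsUnit (x + y) := by
  have := h.neg.isUnit_add_left_of_commute (h2.mul hx) (Commute.all _ _)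
  convert this using 1
  ring

theorem stmt12 (p k : ℕ) (hp : p.Prime) (hp3 : 3 < p) (hk : 1 ≤ k)
    (d : ZMod (p ^ k)) (hd : IsUnit d)
    (x1 x2 y1 y2 : ZMod (p ^ k))
    (hN : x1 ^ 2 - d ^ 2 * x2 ^ 2 = y1 ^ 2 - d ^ 2 * y2 ^ 2)
    (hx : (p : ZMod (p ^ k)) ∣ x1 - d * x2) (hy : (p : ZMod (p ^ k)) ∣ y1 - d * y2)
    (hx1 : IsUnit x1) (hy1 : IsUnit y1) :
    ∃ a b : ZMod (p ^ k), a ^ 2 - d ^ 2 * b ^ 2 = 1 ∧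
      y1 = a * x1 + d ^ 2 * b * x2 ∧ y2 = b * x1 + a * x2 := by
  have h2 : IsUnit (2 : ZMod (p ^ k)) := by
    have hcop : Nat.Coprime 2 (p ^ k) :=
      ((Nat.coprime_primes Nat.prime_two hp).2 (by omega)).pow_right k
    exact_mod_cast (ZMod.isUnit_iff_coprime 2 (p ^ k)).2 hcop
  have hnil {z : ZMod (p ^ k)} (hz : (p : ZMod (p ^ k)) ∣ z) : IsNilpotent z := by
    refine ⟨k, zero_dvd_iff.1 ?_⟩
    have hpk : (p : ZMod (p ^ k)) ^ k = 0 := by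
      rw [← Nat.cast_pow, ZMod.natCast_self]
    exact hpk ▸ pow_dvd_pow_of_dvd hz k
  exact exists_norm_one_of_isUnit_add h2 hd hN
    (isUnit_add_of_isNilpotent_sub h2 hx1 (hnil hx))
    (isUnit_add_of_isNilpotent_sub h2 hy1 (hnil hy))
end

section
/- Let p > 3 be a prime and k ≥ 1 an integer. Let D ∈ ℤ/p^kℤ be divisible by p and let C ∈ ℤ/p^kℤ be a unit such that −C is a quadratic residue modulo p (i.e. (−C/p) = 1 for the Legendre symbol of a representative of −C). Then the number of pairs (x1, x2) ∈ (ℤ/p^kℤ)² satisfying x1² − D·x2² = −C equals 2·p^k. -/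
theorem ZMod.isLocalRing_prime_pow (p k : ℕ) [Fact p.Prime] (hk : k ≠ 0) :
    IsLocalRing (ZMod (p ^ k)) := by
  have hp : p.Prime := Fact.out
  have : NeZero (p ^ k) := ⟨pow_ne_zero _ hp.ne_zero⟩
  have : Fact (1 < p ^ k) := ⟨Nat.one_lt_pow hk hp.one_lt⟩
  have key (a : ZMod (p ^ k)) : IsUnit a ∨ (p : ZMod (p ^ k)) ∣ a := by
    rw [← ZMod.natCast_zmod_val a, ZMod.isUnit_natCast_iff_not_dvd_pow hp (by lia)]
    exact (em' _).imp_right Nat.cast_dvd_cast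
  have hnil : IsNilpotent (p : ZMod (p ^ k)) :=
    ⟨k, by rw [← Nat.cast_pow, ZMod.natCast_self]⟩
  refine .of_nonunits_add fun a b ha hb ↦ ?_
  obtain ⟨c, rfl⟩ := (key a).resolve_left ha
  obtain ⟨d, rfl⟩ := (key b).resolve_left hb
  rw [← mul_add]
  exact ((Commute.all _ _).isNilpotent_mul_right hnil).not_isUnit

/-- In a local ring in which `2` is a unit, a unit that is a square up to a nilpotent
has exactly two square roots. -/
theorem IsLocalRing.ncard_sq_eq_of_isNilpotent {R : Type*} [CommRing R] [IsLocalRing R]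
    (h2 : IsUnit (2 : R)) {s u : R} (hs : IsUnit s) (hsu : IsNilpotent (s ^ 2 - u)) :
    {x : R | x ^ 2 = u}.ncard = 2 := by
  obtain ⟨r, ⟨hr, hroot⟩, -⟩ := Polynomial.existsUnique_nilpotent_sub_and_aeval_eq_zero
    (P := (Polynomial.X ^ 2 - Polynomial.C u : Polynomial R)) (x := s)
    (by simpa using hsu) (by simpa [one_add_one_eq_two] using h2.mul hs)
  have hru : r ^ 2 = u := by simpa [sub_eq_zero] using hroot
  have hr_unit : IsUnit r := by
    have := hr.neg.isUnit_add_left_of_commute hs (Commute.all _ _)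
    simpa using this
  have h2r := h2.mul hr_unit
  have hset : {x : R | x ^ 2 = u} = {r, -r} := by
    ext x
    simp only [Set.mem_ofPred_eq, Set.mem_insert_iff, Set.mem_singleton_iff]
    refine ⟨fun hx ↦ ?_, by rintro (rfl | rfl) <;> simp [hru]⟩
    have hmul : (r - x) * (r + x) = 0 := by linear_combination hru - hx
    have hadd : IsUnit ((r - x) + (r + x)) := by convert h2r using 1; ring
    rcases IsLocalRing.isUnit_or_isUnit_of_isUnit_add hadd with h | h
    · exact .inr (by linear_combination h.mul_right_eq_zero.mp hmul)
    · exact .inl (by linear_combination -h.mul_left_eq_zero.mp hmul)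
  rw [hset, Set.ncard_pair]
  intro h
  exact h2r.ne_zero (by linear_combination h)

theorem stmt13 (p k : ℕ) [NeZero p] [Fact p.Prime] (hp3 : 3 < p) (hk : 1 ≤ k)
    (C D : ZMod (p ^ k)) (hD : (p : ZMod (p ^ k)) ∣ D) (hC : IsUnit C)
    (hQR : legendreSym p (((-C).val : ℤ)) = 1) :
    (Finset.univ.filter fun xy : ZMod (p ^ k) × ZMod (p ^ k) =>
        xy.1 ^ 2 - D * xy.2 ^ 2 = -C).card = 2 * p ^ k := by
  have hp : p.Prime := Fact.out
  have := ZMod.isLocalRing_prime_pow p k (by lia)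
  have hnil : IsNilpotent (p : ZMod (p ^ k)) :=
    ⟨k, by rw [← Nat.cast_pow, ZMod.natCast_self]⟩
  have h2 : IsUnit (2 : ZMod (p ^ k)) := by
    have h : IsUnit ((2 : ℕ) : ZMod (p ^ k)) := by
      rw [ZMod.isUnit_natCast_iff_not_dvd_pow hp hk]
      exact Nat.not_dvd_of_pos_of_lt two_pos (by lia)
    exact_mod_cast h
  obtain ⟨s, t, hst⟩ : ∃ s t : ZMod (p ^ k), s ^ 2 + C = p * t := by
    have h0 : (((-C).val : ℤ) : ZMod p) ≠ 0 := fun h ↦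
      zero_ne_one (((legendreSym.eq_zero_iff p _).mpr h).symm.trans hQR)
    obtain ⟨s, hs⟩ := (legendreSym.eq_one_iff p h0).mp hQR
    have hdvd : (p : ℤ) ∣ (s.val : ℤ) ^ 2 - (-C).val := by
      rw [← ZMod.intCast_zmod_eq_zero_iff_dvd]
      push_cast at hs ⊢
      rw [hs, ZMod.natCast_zmod_val]
      ring
    obtain ⟨t, ht⟩ := hdvd
    refine ⟨s.val, t, ?_⟩
    have h := congrArg (Int.cast : ℤ → ZMod (p ^ k)) ht
    push_cast at h
    rw [ZMod.natCast_zmod_val] at h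
    linear_combination h
  have hs : IsUnit s := by
    have h : IsUnit (-C + p * t) :=
      ((Commute.all _ _).isNilpotent_mul_right hnil).isUnit_add_left_of_commute
        hC.neg (Commute.all _ _)
    rw [show -C + p * t = s ^ 2 by linear_combination -hst] at h
    exact (isUnit_pow_iff two_ne_zero).mp h
  obtain ⟨d, rfl⟩ := hD
  have hfiber (y : ZMod (p ^ k)) :
      (Finset.univ.filter fun x : ZMod (p ^ k) ↦ x ^ 2 - p * d * y ^ 2 = -C).card = 2 := by
    rw [← Set.ncard_coe_finset]
    convert IsLocalRing.ncard_sq_eq_of_isNilpotent h2 hs (u := p * d * y ^ 2 - C) ?_ using 2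
    · ext x
      simp only [Finset.coe_filter, Finset.mem_univ, true_and, Set.mem_ofPred_eq]
      constructor <;> intro h <;> linear_combination h
    · rw [show s ^ 2 - (p * d * y ^ 2 - C) = p * (t - d * y ^ 2) by linear_combination hst]
      exact (Commute.all _ _).isNilpotent_mul_right hnil
  rw [Finset.card_filter, Fintype.sum_prod_type_right]
  simp_rw [← Finset.card_filter, hfiber]
  simp [ZMod.card, mul_comm]
end

section
/- Let p > 3 be a prime, let k ≥ 1 and s ≥ 0 be integers with 2s ≤ k, and set N = p^{2k}. Let r, D ∈ ℤ/Nℤ with 2·r = 1 in ℤ/Nℤ, and let q = p^{k−s} (viewed in ℤ/Nℤ). Let B be the 2×2 matrix over ℤ/Nℤ given by B = [[1 + r·D·q², q·D],[q, 1 + r·D·q²]]. Then for every natural number z (with z, z², z³ reduced modulo N): B^z = [[1 + r·D·z²·q², (q·z + 3^{−1}·r·D·q³·(z³ − z))·D],[q·z + 3^{−1}·r·D·q³·(z³ − z), 1 + r·D·z²·q²]], where 3^{−1} is the inverse of 3 in ℤ/Nℤ. In particular, B^{p^s} = [[1, p^k·D],[p^k, 1]]. -/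
theorem stmt19 (p k s : ℕ) [NeZero p] (hp : p.Prime) (hp3 : 3 < p) (hk : 1 ≤ k)
    (hs : 2 * s ≤ k)
    (r D i3 : ZMod (p ^ (2 * k))) (hr : 2 * r = 1) (hi3 : 3 * i3 = 1)
    (q : ZMod (p ^ (2 * k))) (hq : q = (p : ZMod (p ^ (2 * k))) ^ (k - s))
    (B : Matrix (Fin 2) (Fin 2) (ZMod (p ^ (2 * k))))
    (hB : B = !![1 + r * D * q ^ 2, q * D; q, 1 + r * D * q ^ 2]) :
    (∀ z : ℕ,
      B ^ z =
        !![1 + r * D * (z : ZMod (p ^ (2 * k))) ^ 2 * q ^ 2,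
            (q * (z : ZMod (p ^ (2 * k))) +
              i3 * r * D * q ^ 3 * ((z : ZMod (p ^ (2 * k))) ^ 3 - (z : ZMod (p ^ (2 * k))))) * D;
           q * (z : ZMod (p ^ (2 * k))) +
              i3 * r * D * q ^ 3 * ((z : ZMod (p ^ (2 * k))) ^ 3 - (z : ZMod (p ^ (2 * k)))),
            1 + r * D * (z : ZMod (p ^ (2 * k))) ^ 2 * q ^ 2]) ∧
    B ^ (p ^ s) =
      !![1, (p : ZMod (p ^ (2 * k))) ^ k * D; (p : ZMod (p ^ (2 * k))) ^ k, 1] := by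
  have hp0 : ∀ n, 2 * k ≤ n → (p : ZMod (p ^ (2 * k))) ^ n = 0 := by
    intro n hn
    apply pow_eq_zero_of_le hn
    exact_mod_cast ZMod.natCast_self (p ^ (2 * k))
  have hq4 : q ^ 4 = 0 := by
    rw [hq, ← pow_mul]
    exact hp0 _ (by omega)
  have hpow : ∀ z : ℕ,
      B ^ z =
        !![1 + r * D * (z : ZMod (p ^ (2 * k))) ^ 2 * q ^ 2,
            (q * (z : ZMod (p ^ (2 * k))) +
              i3 * r * D * q ^ 3 * ((z : ZMod (p ^ (2 * k))) ^ 3 - (z : ZMod (p ^ (2 * k))))) * D;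
           q * (z : ZMod (p ^ (2 * k))) +
              i3 * r * D * q ^ 3 * ((z : ZMod (p ^ (2 * k))) ^ 3 - (z : ZMod (p ^ (2 * k)))),
            1 + r * D * (z : ZMod (p ^ (2 * k))) ^ 2 * q ^ 2] := by
    intro z
    induction z with
    | zero => simp [Matrix.one_fin_two]
    | succ z ih =>
      rw [pow_succ, ih, hB, Matrix.mul_fin_two]
      push_cast
      generalize (z : ZMod (p ^ (2 * k))) = x
      have hdiag : (1 + r * D * x ^ 2 * q ^ 2) * (1 + r * D * q ^ 2) +
          (q * x + i3 * r * D * q ^ 3 * (x ^ 3 - x)) * D * q =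
          1 + r * D * (x + 1) ^ 2 * q ^ 2 := by
        linear_combination (r ^ 2 * D ^ 2 * x ^ 2 + i3 * r * D ^ 2 * (x ^ 3 - x)) * hq4 -
          q ^ 2 * x * D * hr
      have hoff : (q * x + i3 * r * D * q ^ 3 * (x ^ 3 - x)) * (1 + r * D * q ^ 2) +
          (1 + r * D * x ^ 2 * q ^ 2) * q =
          q * (x + 1) + i3 * r * D * q ^ 3 * ((x + 1) ^ 3 - (x + 1)) := by
        linear_combination i3 * r ^ 2 * D ^ 2 * q * (x ^ 3 - x) * hq4 -
          r * D * q ^ 3 * (x + x ^ 2) * hi3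
      have hoff' : (1 + r * D * x ^ 2 * q ^ 2) * (q * D) +
          (q * x + i3 * r * D * q ^ 3 * (x ^ 3 - x)) * D * (1 + r * D * q ^ 2) =
          (q * (x + 1) + i3 * r * D * q ^ 3 * ((x + 1) ^ 3 - (x + 1))) * D := by
        linear_combination D * hoff
      have hdiag' : (q * x + i3 * r * D * q ^ 3 * (x ^ 3 - x)) * (q * D) +
          (1 + r * D * x ^ 2 * q ^ 2) * (1 + r * D * q ^ 2) =
          1 + r * D * (x + 1) ^ 2 * q ^ 2 := by
        linear_combination hdiag
      rw [hdiag, hoff, hoff', hdiag']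
  refine ⟨hpow, ?_⟩
  have hqz : q * (p : ZMod (p ^ (2 * k))) ^ s = (p : ZMod (p ^ (2 * k))) ^ k := by
    rw [hq, ← pow_add]
    congr 1
    omega
  have hsq : ((p : ZMod (p ^ (2 * k))) ^ s) ^ 2 * q ^ 2 = 0 := by
    rw [← mul_pow, mul_comm (_ ^ s) q, hqz, ← pow_mul]
    exact hp0 _ (by omega)
  have hcube : q ^ 3 * (p : ZMod (p ^ (2 * k))) ^ s = 0 := by
    rw [hq, ← pow_mul, ← pow_add]
    exact hp0 _ (by omega)
  have hdiag : 1 + r * D * ((p : ZMod (p ^ (2 * k))) ^ s) ^ 2 * q ^ 2 = 1 := by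
    linear_combination r * D * hsq
  have hoff : q * (p : ZMod (p ^ (2 * k))) ^ s + i3 * r * D * q ^ 3 *
      (((p : ZMod (p ^ (2 * k))) ^ s) ^ 3 - (p : ZMod (p ^ (2 * k))) ^ s) =
      (p : ZMod (p ^ (2 * k))) ^ k := by
    linear_combination hqz +
      i3 * r * D * (((p : ZMod (p ^ (2 * k))) ^ s) ^ 2 - 1) * hcube
  rw [hpow, Nat.cast_pow, hdiag, hoff]
end
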